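/- arXiv:2209.03399 — 2 statements merged into one kernel-verified Lean document; each statement's English description precedes it below -/
import Mathlib

section
/- For every real p > 2, ∫_0^∞ ∫_0^∞ (2γ + log(xy)) / (1 + x + y)^p dx dy = −2ψ(p−2) / ((p−1)(p−2)), where γ is the Euler–Mascheroni constant and ψ is the digamma function. -/
open MeasureTheory Set

/-- The digamma function `ψ = Γ'/Γ`. -/
noncomputable def digamma (x : ℝ) : ℝ := deriv Real.Gamma x / Real.Gamma x

theorem integrableOn_log_mul_Gamma_integrand {s : ℝ} (hs : 0 < s) :
    IntegrableOn (fun t : ℝ ↦ Real.log t * (Real.exp (-t) * t ^ (s - 1))) (Ioi 0) := by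
  have h := (mellin_hasDerivAt_of_isBigO_rpow (E := ℂ) (f := fun x ↦ ((Real.exp (-x) : ℝ) : ℂ))
    (a := s + 1) (b := 0) (s := s) ?_ ?_ (by simp) ?_ (by simpa)).1
  · refine Integrable.congr (Integrable.re h) ?_
    filter_upwards [self_mem_ae_restrict measurableSet_Ioi] with t ht
    have : ((t : ℂ) ^ ((s : ℂ) - 1)) = ((t ^ (s - 1) : ℝ) : ℂ) := by
      rw [Complex.ofReal_cpow (le_of_lt ht)]; simp
    rw [this]
    simp only [smul_eq_mul, Complex.real_smul, ← Complex.ofReal_mul, RCLike.re_to_complex,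
      Complex.ofReal_re]
    ring
  · refine (Continuous.continuousOn ?_).locallyIntegrableOn measurableSet_Ioi
    fun_prop
  · rw [← Asymptotics.isBigO_norm_left]
    simp_rw [Complex.norm_real, Asymptotics.isBigO_norm_left]
    simpa only [neg_one_mul] using (isLittleO_exp_neg_mul_rpow_atTop zero_lt_one _).isBigO
  · simp_rw [neg_zero, Real.rpow_zero]
    refine Asymptotics.isBigO_const_of_tendsto (y := (1 : ℂ)) ?_ one_ne_zero
    have : Continuous fun x : ℝ ↦ ((Real.exp (-x) : ℝ) : ℂ) := by fun_prop
    simpa using this.continuousWithinAt (s := Ioi 0) (x := 0) |>.tendsto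

/-- The derivative of the Gamma function as an integral. -/
theorem integral_log_mul_Gamma_integrand {s : ℝ} (hs : 0 < s) :
    ∫ t : ℝ in Ioi 0, Real.log t * (Real.exp (-t) * t ^ (s - 1)) = deriv Real.Gamma s := by
  have h := Complex.hasDerivAt_GammaIntegral (s := s) (by simpa)
  have e : (∫ t : ℝ in Ioi 0, (t : ℂ) ^ ((s : ℂ) - 1) * (Real.log t * Real.exp (-t))) =
      ((∫ t : ℝ in Ioi 0, Real.log t * (Real.exp (-t) * t ^ (s - 1)) : ℝ) : ℂ) := by
    rw [← integral_complex_ofReal]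
    refine setIntegral_congr_fun measurableSet_Ioi fun t ht ↦ ?_
    have : ((t : ℂ) ^ ((s : ℂ) - 1)) = ((t ^ (s - 1) : ℝ) : ℂ) := by
      rw [Complex.ofReal_cpow (le_of_lt ht)]; simp
    simp only [this]
    push_cast
    ring
  rw [e] at h
  have h' := h.real_of_complex
  rw [Complex.ofReal_re] at h'
  refine (h'.congr_of_eventuallyEq ?_).deriv.symm
  filter_upwards [lt_mem_nhds hs] with x hx
  rw [Real.Gamma_eq_integral hx, Complex.GammaIntegral_ofReal, Complex.ofReal_re]

/-- The Laplace transform of the logarithm. -/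
theorem integral_log_mul_exp_neg_mul {t : ℝ} (ht : 0 < t) :
    ∫ u : ℝ in Ioi 0, Real.log u * Real.exp (-(t * u)) =
      -(Real.eulerMascheroniConstant + Real.log t) / t := by
  have hi := integrableOn_log_mul_Gamma_integrand one_pos
  have hv := integral_log_mul_Gamma_integrand one_pos
  simp only [sub_self, Real.rpow_zero, mul_one, Real.hasDerivAt_Gamma_one.deriv] at hi hv
  have hs := integral_comp_mul_left_Ioi
    (fun x ↦ (Real.log x - Real.log t) * Real.exp (-x)) 0 ht
  have hc : ∫ u : ℝ in Ioi 0, Real.log u * Real.exp (-(t * u)) =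
      ∫ u : ℝ in Ioi 0, (Real.log (t * u) - Real.log t) * Real.exp (-(t * u)) := by
    refine setIntegral_congr_fun measurableSet_Ioi fun u hu ↦ ?_
    simp only [Real.log_mul ht.ne' (ne_of_gt hu), add_sub_cancel_left]
  rw [hc, hs, mul_zero]
  simp_rw [sub_mul]
  rw [integral_sub hi ((integrableOn_exp_neg_Ioi 0).const_mul _), hv, integral_const_mul,
    integral_exp_neg_Ioi_zero, smul_eq_mul]
  ring

theorem integrableOn_one_add_rpow_neg {q : ℝ} (hq : 1 < q) :
    IntegrableOn (fun u : ℝ ↦ (1 + u) ^ (-q)) (Ioi 0) := by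
  simpa only [add_comm] using
    integrableOn_add_rpow_Ioi_of_lt (a := -q) (c := 0) (m := 1) (by linarith) (by simp)

theorem integrableOn_log_mul_one_add_rpow_neg {q : ℝ} (hq : 1 < q) :
    IntegrableOn (fun u : ℝ ↦ Real.log u * (1 + u) ^ (-q)) (Ioi 0) := by
  have hm : Measurable fun u : ℝ ↦ Real.log u * (1 + u) ^ (-q) := by fun_prop
  rw [← Ioc_union_Ioi_eq_Ioi (zero_le_one' ℝ), integrableOn_union]
  constructor
  · have h := (intervalIntegrable_iff_integrableOn_Ioc_of_le (zero_le_one' ℝ)).1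
      (intervalIntegral.intervalIntegrable_log' (a := 0) (b := 1))
    refine Integrable.mono h hm.aestronglyMeasurable ?_
    filter_upwards [self_mem_ae_restrict measurableSet_Ioc] with u hu
    rw [norm_mul]
    refine mul_le_of_le_one_right (norm_nonneg _) ?_
    rw [Real.norm_of_nonneg (Real.rpow_nonneg (by linarith [hu.1]) _)]
    exact Real.rpow_le_one_of_one_le_of_nonpos (by linarith [hu.1]) (by linarith)
  · set e := (q - 1) / 2 with he
    have he0 : 0 < e := by linarith
    have h := (integrableOn_Ioi_rpow_of_lt (a := e - q) (c := 1) (by linarith) one_pos).const_mul e⁻¹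
    refine h.mono' hm.aestronglyMeasurable ?_
    filter_upwards [self_mem_ae_restrict measurableSet_Ioi] with u (hu : 1 < u)
    have hu0 : 0 < u := by linarith
    rw [Real.norm_of_nonneg (mul_nonneg (Real.log_nonneg hu.le) (Real.rpow_nonneg (by linarith) _)),
      sub_eq_add_neg, Real.rpow_add hu0, ← mul_assoc]
    have h1 := Real.log_le_rpow_div hu0.le he0
    rw [div_eq_inv_mul] at h1
    exact mul_le_mul h1 (Real.rpow_le_rpow_of_nonpos hu0 (by linarith) (by linarith))
      (by positivity) (by positivity)

theorem integral_one_add_rpow_neg {q : ℝ} (hq : 1 < q) :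
    ∫ u : ℝ in Ioi 0, (1 + u) ^ (-q) = 1 / (q - 1) := by
  have h := (measurePreserving_add_left volume (1 : ℝ)).setIntegral_preimage_emb
    (measurableEmbedding_addLeft 1) (fun x : ℝ ↦ x ^ (-q)) (Ioi 1)
  rw [preimage_const_add_Ioi, sub_self, integral_Ioi_rpow_of_lt (by linarith) one_pos] at h
  rw [h, Real.one_rpow, neg_div, ← div_neg]
  ring

open Filter Topology in
theorem integral_log_one_add_mul_rpow_neg {q : ℝ} (hq : 1 < q) :
    IntegrableOn (fun u : ℝ ↦ Real.log (1 + u) * (1 + u) ^ (-q)) (Ioi 0) ∧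
    ∫ u : ℝ in Ioi 0, Real.log (1 + u) * (1 + u) ^ (-q) = 1 / (q - 1) ^ 2 := by
  set g : ℝ → ℝ := fun u ↦ -(Real.log (1 + u) / (q - 1) + 1 / (q - 1) ^ 2) * (1 + u) ^ (1 - q)
  have hq0 : q - 1 ≠ 0 := by linarith
  have hd : ∀ u ∈ Ici (0 : ℝ), HasDerivAt g (Real.log (1 + u) * (1 + u) ^ (-q)) u := by
    intro u (hu : 0 ≤ u)
    have h1 : 0 < 1 + u := by linarith
    have ha : HasDerivAt (fun u : ℝ ↦ 1 + u) 1 u := (hasDerivAt_id u).const_add 1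
    convert! ((((ha.log h1.ne').div_const (q - 1)).add_const (1 / (q - 1) ^ 2)).neg).mul
      (ha.rpow_const (p := 1 - q) (Or.inl h1.ne')) using 1
    have e : (1 + u) ^ (1 - q) = (1 + u) * (1 + u) ^ (-q) := by
      rw [sub_eq_add_neg, Real.rpow_add h1, Real.rpow_one]
    rw [show 1 - q - 1 = -q by ring, e]
    simp only [Pi.neg_apply]
    field_simp
    ring
  have hp : ∀ u ∈ Ioi (0 : ℝ), 0 ≤ Real.log (1 + u) * (1 + u) ^ (-q) := by
    intro u (hu : 0 < u)
    exact mul_nonneg (Real.log_nonneg (by linarith)) (Real.rpow_nonneg (by linarith) _)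
  have ht : Tendsto g atTop (𝓝 0) := by
    have hl : Tendsto (fun x : ℝ ↦ -(Real.log x / (q - 1) + 1 / (q - 1) ^ 2) * x ^ (1 - q))
        atTop (𝓝 0) := by
      have h1 : Tendsto (fun x : ℝ ↦ x ^ (1 - q)) atTop (𝓝 0) := by
        simpa using tendsto_rpow_neg_atTop (y := q - 1) (by linarith)
      have h2 : Tendsto (fun x : ℝ ↦ Real.log x * x ^ (1 - q)) atTop (𝓝 0) := by
        refine (isLittleO_log_rpow_atTop (r := q - 1) (by linarith)).tendsto_div_nhds_zero.congr' ?_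
        filter_upwards [eventually_gt_atTop 0] with x hx
        rw [div_eq_mul_inv, ← Real.rpow_neg hx.le, neg_sub]
      convert (h2.const_mul (-(1 / (q - 1)))).sub (h1.const_mul (1 / (q - 1) ^ 2)) using 2
      · ring
      · ring
    exact hl.comp (tendsto_atTop_add_const_left _ 1 tendsto_id)
  refine ⟨integrableOn_Ioi_deriv_of_nonneg' hd hp ht, ?_⟩
  rw [integral_Ioi_of_hasDerivAt_of_nonneg' hd hp ht]
  simp [g]

theorem integral_log_mul_one_add_rpow_neg {q : ℝ} (hq : 1 < q) :
    ∫ u : ℝ in Ioi 0, Real.log u * (1 + u) ^ (-q) =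
      -(Real.eulerMascheroniConstant + digamma (q - 1)) / (q - 1) := by
  have hΓ : 0 < Real.Gamma q := Real.Gamma_pos_of_pos (by linarith)
  have hΓ' : 0 < Real.Gamma (q - 1) := Real.Gamma_pos_of_pos (by linarith)
  have hrec : Real.Gamma q = (q - 1) * Real.Gamma (q - 1) := by
    simpa using Real.Gamma_add_one (s := q - 1) (by linarith)
  have hker : ∀ u ∈ Ioi (0 : ℝ), ∫ t : ℝ in Ioi 0, t ^ (q - 1) * Real.exp (-((1 + u) * t)) =
      (1 + u) ^ (-q) * Real.Gamma q := by
    intro u (hu : 0 < u)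
    rw [Real.integral_rpow_mul_exp_neg_mul_Ioi (by linarith) (by linarith), one_div,
      Real.inv_rpow (by linarith), Real.rpow_neg (by linarith)]
  let F : ℝ → ℝ → ℝ := fun u t ↦ Real.log u * (t ^ (q - 1) * Real.exp (-((1 + u) * t)))
  have hF : Integrable (Function.uncurry F)
      ((volume.restrict (Ioi 0)).prod (volume.restrict (Ioi 0))) := by
    have hm : Measurable (Function.uncurry F) := by
      simp only [Function.uncurry_def, F]; fun_prop
    rw [integrable_prod_iff hm.aestronglyMeasurable]
    constructor
    · filter_upwards [self_mem_ae_restrict measurableSet_Ioi] with u (hu : 0 < u)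
      refine Integrable.const_mul (f := fun t ↦ t ^ (q - 1) * Real.exp (-((1 + u) * t)))
        (not_imp_comm.1 integral_undef ?_) (Real.log u)
      rw [hker u hu]
      have : 0 < (1 + u) ^ (-q) := Real.rpow_pos_of_pos (by linarith) _
      positivity
    · refine ((integrableOn_log_mul_one_add_rpow_neg hq).norm.mul_const (Real.Gamma q)).congr ?_
      filter_upwards [self_mem_ae_restrict measurableSet_Ioi] with u (hu : 0 < u)
      have : ∀ t ∈ Ioi (0 : ℝ), ‖Function.uncurry F (u, t)‖ =
          ‖Real.log u‖ * (t ^ (q - 1) * Real.exp (-((1 + u) * t))) := by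
        intro t (ht : 0 < t)
        simp only [Function.uncurry_apply_pair, F, norm_mul, Real.norm_of_nonneg (Real.exp_nonneg _),
          Real.norm_of_nonneg (Real.rpow_nonneg ht.le _)]
      rw [setIntegral_congr_fun measurableSet_Ioi this, integral_const_mul, hker u hu, norm_mul,
        Real.norm_of_nonneg (Real.rpow_nonneg (by linarith : 0 ≤ 1 + u) _), mul_assoc]
  have hl : ∫ u : ℝ in Ioi 0, ∫ t : ℝ in Ioi 0, F u t =
      (∫ u : ℝ in Ioi 0, Real.log u * (1 + u) ^ (-q)) * Real.Gamma q := by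
    rw [← integral_mul_const]
    refine setIntegral_congr_fun measurableSet_Ioi fun u hu ↦ ?_
    simp only [F]
    rw [integral_const_mul, hker u hu, mul_assoc]
  have hr : ∫ t : ℝ in Ioi 0, ∫ u : ℝ in Ioi 0, F u t =
      -(Real.eulerMascheroniConstant * Real.Gamma (q - 1) + deriv Real.Gamma (q - 1)) := by
    have hq1 : 0 < q - 1 := by linarith
    rw [Real.Gamma_eq_integral hq1, ← integral_log_mul_Gamma_integrand hq1, ← integral_const_mul,
      ← integral_add ((Real.GammaIntegral_convergent hq1).const_mul _)
        (integrableOn_log_mul_Gamma_integrand hq1), ← integral_neg]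
    refine setIntegral_congr_fun measurableSet_Ioi fun t (ht : 0 < t) ↦ ?_
    have : ∀ u, F u t = t ^ (q - 1) * Real.exp (-t) * (Real.log u * Real.exp (-(t * u))) := by
      intro u
      simp only [F]
      rw [show -((1 + u) * t) = -t + -(t * u) by ring, Real.exp_add]
      ring
    simp only [this]
    rw [integral_const_mul, integral_log_mul_exp_neg_mul ht, Real.rpow_sub_one ht.ne' (q - 1)]
    ring
  have hswap := integral_integral_swap hF
  rw [hl, hr, hrec] at hswap
  rw [digamma]
  have : q - 1 ≠ 0 := by linarith
  field_simp
  linarith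

theorem digamma_add_one {x : ℝ} (hx : 0 < x) : digamma (x + 1) = digamma x + 1 / x := by
  have hΓ := Real.Gamma_pos_of_pos hx
  have hd : DifferentiableAt ℝ Real.Gamma x :=
    Real.differentiableAt_Gamma fun m ↦ by have : (0 : ℝ) ≤ m := m.cast_nonneg; linarith
  have h1 : HasDerivAt (fun y ↦ y * Real.Gamma y) (1 * Real.Gamma x + x * deriv Real.Gamma x) x :=
    (hasDerivAt_id x).mul hd.hasDerivAt
  have h2 : deriv Real.Gamma (x + 1) = 1 * Real.Gamma x + x * deriv Real.Gamma x := by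
    rw [← deriv_comp_add_const, ← h1.deriv]
    refine Filter.EventuallyEq.deriv_eq ?_
    filter_upwards [lt_mem_nhds hx] with y hy using Real.Gamma_add_one hy.ne'
  rw [digamma, digamma, h2, Real.Gamma_add_one hx.ne']
  field_simp
  ring

/-- The integral of an affine function of `log` against a shifted power. -/
theorem integral_const_add_log_mul_add_rpow_neg {a q : ℝ} (ha : 0 < a) (hq : 1 < q) (c : ℝ) :
    ∫ x : ℝ in Ioi 0, (c + Real.log x) * (a + x) ^ (-q) =
      a ^ (1 - q) / (q - 1) *
        (c + Real.log a - Real.eulerMascheroniConstant - digamma (q - 1)) := by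
  have h := integral_comp_mul_left_Ioi' (fun x ↦ (c + Real.log x) * (a + x) ^ (-q)) 0 ha
  rw [mul_zero] at h
  have e : ∀ x ∈ Ioi (0 : ℝ), (c + Real.log (a * x)) * (a + a * x) ^ (-q) =
      a ^ (-q) * ((c + Real.log a) * (1 + x) ^ (-q) + Real.log x * (1 + x) ^ (-q)) := by
    intro x (hx : 0 < x)
    rw [Real.log_mul ha.ne' hx.ne', show a + a * x = a * (1 + x) by ring,
      Real.mul_rpow ha.le (by linarith)]
    ring
  rw [← h, setIntegral_congr_fun measurableSet_Ioi e, integral_const_mul,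
    integral_add ((integrableOn_one_add_rpow_neg hq).const_mul _)
      (integrableOn_log_mul_one_add_rpow_neg hq), integral_const_mul,
    integral_one_add_rpow_neg hq, integral_log_mul_one_add_rpow_neg hq, smul_eq_mul,
    sub_eq_add_neg 1 q, Real.rpow_add ha, Real.rpow_one]
  ring

theorem double_integral_log_power (p : ℝ) (hp : 2 < p) :
    ∫ y : ℝ in Ioi 0, ∫ x : ℝ in Ioi 0,
        (2 * Real.eulerMascheroniConstant + Real.log (x * y)) / (1 + x + y) ^ p
      = -2 * digamma (p - 2) / ((p - 1) * (p - 2)) := by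
  have hq : 1 < p - 1 := by linarith
  have hinner : ∀ y ∈ Ioi (0 : ℝ), ∫ x : ℝ in Ioi 0,
      (2 * Real.eulerMascheroniConstant + Real.log (x * y)) / (1 + x + y) ^ p =
      1 / (p - 1) * ((Real.eulerMascheroniConstant - digamma (p - 1)) * (1 + y) ^ (-(p - 1)) +
        Real.log y * (1 + y) ^ (-(p - 1)) + Real.log (1 + y) * (1 + y) ^ (-(p - 1))) := by
    intro y (hy : 0 < y)
    have e : ∀ x ∈ Ioi (0 : ℝ),
        (2 * Real.eulerMascheroniConstant + Real.log (x * y)) / (1 + x + y) ^ p =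
        (2 * Real.eulerMascheroniConstant + Real.log y + Real.log x) * (1 + y + x) ^ (-p) := by
      intro x (hx : 0 < x)
      rw [Real.log_mul hx.ne' hy.ne', add_right_comm 1 x y, Real.rpow_neg (by linarith)]
      ring
    rw [setIntegral_congr_fun measurableSet_Ioi e,
      integral_const_add_log_mul_add_rpow_neg (by linarith) (by linarith), neg_sub]
    ring
  obtain ⟨hi, hv⟩ := integral_log_one_add_mul_rpow_neg hq
  have hi1 := (integrableOn_one_add_rpow_neg hq).const_mul
    (Real.eulerMascheroniConstant - digamma (p - 1))
  have hi2 := integrableOn_log_mul_one_add_rpow_neg hq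
  have hψ := digamma_add_one (x := p - 2) (by linarith)
  rw [show p - 2 + 1 = p - 1 by ring] at hψ
  have hsum := integral_add (hi1.add hi2) hi
  simp only [Pi.add_apply] at hsum
  rw [setIntegral_congr_fun measurableSet_Ioi hinner, integral_const_mul,
    hsum, integral_add hi1 hi2, integral_const_mul, hv,
    integral_one_add_rpow_neg hq, integral_log_mul_one_add_rpow_neg hq,
    show p - 1 - 1 = p - 2 by ring, hψ]
  have : p - 2 ≠ 0 := by linarith
  have : p - 1 ≠ 0 := by linarith
  field_simp
  ring
end

section
/- For every real t > 0, ∫_0^∞ e^{−tx} · e^{−πx/12} · ∏_{n=1}^∞ (1 − e^{−2πnx}) dx = √(π/t) · sinh(2√(πt/3)) / cosh(√(3πt)). -/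
open MeasureTheory Set Filter Topology

lemma summable_inv_add_int_sub_inv_add_int {z w : ℂ} (hz : z ∈ Complex.integerComplement)
    (hw : w ∈ Complex.integerComplement) :
    Summable fun n : ℤ ↦ 1 / (z + n) - 1 / (w + n) := by
  have hs (x : ℂ) : Summable fun n : ℤ ↦ ‖((x + n) ^ 2)⁻¹‖ := by
    simpa using! (EisensteinSeries.linear_right_summable x 1 (k := 2) le_rfl).norm
  refine Summable.of_norm_bounded (((hs z).add (hs w)).mul_left ‖w - z‖) fun n ↦ ?_
  have hzn := Complex.integerComplement_add_ne_zero hz n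
  have hwn := Complex.integerComplement_add_ne_zero hw n
  have h : 1 / (z + n) - 1 / (w + n) = (w - z) * ((z + n)⁻¹ * (w + n)⁻¹) := by
    field_simp
    ring
  rw [h, norm_mul]
  gcongr
  simp only [norm_mul, norm_inv, norm_pow, ← inv_pow]
  nlinarith [sq_nonneg (‖z + n‖⁻¹ - ‖w + n‖⁻¹), sq_nonneg (‖z + n‖⁻¹), sq_nonneg (‖w + n‖⁻¹)]

/-- The partial fraction expansion of the cotangent, as an absolutely convergent series
over the integers for the difference of two values. -/
lemma hasSum_cot_sub_cot {z w : ℂ} (hz : z ∈ Complex.integerComplement)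
    (hw : w ∈ Complex.integerComplement) :
    HasSum (fun n : ℤ ↦ 1 / (z + n) - 1 / (w + n))
      (Real.pi * Complex.cot (Real.pi * z) - Real.pi * Complex.cot (Real.pi * w)) := by
  obtain ⟨f, hf⟩ : ∃ f : ℤ → ℂ, ∀ n, f n = 1 / (z + n) - 1 / (w + n) := ⟨_, fun _ ↦ rfl⟩
  have hs : Summable f := by
    simpa only [← hf] using summable_inv_add_int_sub_inv_add_int hz hw
  simp only [← hf]
  have hpos : Summable fun n : ℕ ↦ f (n + 1) :=
    hs.comp_injective (i := fun n : ℕ ↦ (n + 1 : ℤ)) fun a b h ↦ by simpa using h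
  have hneg : Summable fun n : ℕ ↦ f (-(n + 1)) :=
    hs.comp_injective (i := fun n : ℕ ↦ (-(n + 1) : ℤ)) fun a b h ↦ by simpa using h
  have hterm (n : ℕ) : f (n + 1) + f (-(n + 1)) = cotTerm z n - cotTerm w n := by
    simp only [cotTerm, hf, Int.cast_neg, Int.cast_add, Int.cast_natCast, Int.cast_one,
      ← sub_eq_add_neg]
    ring
  have hsum {x : ℂ} (hx : x ∈ Complex.integerComplement) :
      ∑' n, cotTerm x n = Real.pi * Complex.cot (Real.pi * x) - 1 / x :=
    (cot_series_rep' hx).symm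
  rw [hs.hasSum_iff, tsum_of_add_one_of_neg_add_one hpos hneg, add_right_comm,
    ← hpos.tsum_add hneg, tsum_congr hterm,
    (summable_cotTerm hz).tsum_sub (summable_cotTerm hw), hsum hz, hsum hw, hf, Int.cast_zero,
    add_zero, add_zero]
  ring

lemma HasSum.int_even_add_odd {M : Type*} [AddCommMonoid M] [TopologicalSpace M] [ContinuousAdd M]
    {f : ℤ → M} {a b : M} (he : HasSum (fun k ↦ f (2 * k)) a)
    (ho : HasSum (fun k ↦ f (2 * k + 1)) b) : HasSum f (a + b) := by
  have hie : Function.Injective fun k : ℤ ↦ 2 * k := fun a b h ↦ by grind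
  have hio : Function.Injective fun k : ℤ ↦ 2 * k + 1 := fun a b h ↦ by grind
  have hre : (range fun k : ℤ ↦ 2 * k) = {n | Even n} := by
    ext n
    exact ⟨fun ⟨k, hk⟩ ↦ even_iff_exists_two_mul.mpr ⟨k, hk.symm⟩,
      fun h ↦ (even_iff_exists_two_mul.mp h).imp fun _ hk ↦ hk.symm⟩
  have hro : (range fun k : ℤ ↦ 2 * k + 1) = {n | Odd n} := by
    ext n
    exact ⟨fun ⟨k, hk⟩ ↦ ⟨k, hk.symm⟩, fun h ↦ h.imp fun _ hk ↦ hk.symm⟩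
  exact HasSum.add_isCompl (hre ▸ hro ▸ Int.isCompl_even_odd)
    (hie.hasSum_range_iff.mpr he) (hio.hasSum_range_iff.mpr ho)

lemma cot_half_sub_cot_half_add_pi_div_two {x : ℂ} (hx : Complex.sin x ≠ 0) :
    Complex.cot (x / 2) - Complex.cot (x / 2 + Real.pi / 2) = 2 / Complex.sin x := by
  have h : Complex.sin x = 2 * Complex.sin (x / 2) * Complex.cos (x / 2) := by
    rw [← Complex.sin_two_mul]; ring_nf
  rw [h] at hx ⊢
  have hs : Complex.sin (x / 2) ≠ 0 := by intro h0; simp [h0] at hx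
  have hc : Complex.cos (x / 2) ≠ 0 := by intro h0; simp [h0] at hx
  simp only [Complex.cot, Complex.sin_add_pi_div_two, Complex.cos_add_pi_div_two]
  field_simp
  linear_combination Complex.sin_sq_add_cos_sq (x / 2)

/-- The partial fraction expansion of the cosecant, for the difference of two values. -/
lemma hasSum_csc_sub_csc {z w : ℂ} (hz : z ∈ Complex.integerComplement)
    (hw : w ∈ Complex.integerComplement) :
    HasSum (fun n : ℤ ↦ (Int.negOnePow n : ℂ) * (1 / (z + n) - 1 / (w + n)))
      (Real.pi / Complex.sin (Real.pi * z) - Real.pi / Complex.sin (Real.pi * w)) := by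
  have hhalf {x : ℂ} (hx : x ∈ Complex.integerComplement) :
      x / 2 ∈ Complex.integerComplement := by
    rintro ⟨n, hn⟩
    exact hx ⟨2 * n, by push_cast; rw [hn]; ring⟩
  have hhalf' {x : ℂ} (hx : x ∈ Complex.integerComplement) :
      (x + 1) / 2 ∈ Complex.integerComplement :=
    hhalf (by simpa using (Complex.add_intCast_mem_integerComplement 1).mpr hx)
  have hhalf_inv (x y : ℂ) : 1 / (x + 2 * y) = 1 / 2 * (1 / (x / 2 + y)) := by
    rw [show x + 2 * y = 2 * (x / 2 + y) by ring, one_div_mul_one_div]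
  have he := (hasSum_cot_sub_cot (hhalf hz) (hhalf hw)).mul_left (1 / 2)
  have ho := (hasSum_cot_sub_cot (hhalf' hz) (hhalf' hw)).mul_left (-(1 / 2))
  convert! HasSum.int_even_add_odd (he.congr_fun fun k ↦ ?_) (ho.congr_fun fun k ↦ ?_) using 1
  · have h1 := cot_half_sub_cot_half_add_pi_div_two (sin_pi_mul_ne_zero hz)
    have h2 := cot_half_sub_cot_half_add_pi_div_two (sin_pi_mul_ne_zero hw)
    have hshift (x : ℂ) : Real.pi * ((x + 1) / 2) = Real.pi * x / 2 + Real.pi / 2 := by ring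
    rw [hshift, hshift, ← mul_div_assoc, ← mul_div_assoc]
    linear_combination (-(Real.pi : ℂ) / 2) * h1 + (Real.pi : ℂ) / 2 * h2
  · have hk : Int.negOnePow (2 * k) = 1 := Int.negOnePow_two_mul k
    rw [hk]
    push_cast
    rw [hhalf_inv, hhalf_inv]
    ring
  · have hk : Int.negOnePow (2 * k + 1) = -1 := Int.negOnePow_two_mul_add_one k
    have hshift (x y : ℂ) : x + (2 * y + 1) = x + 1 + 2 * y := by ring
    rw [hk]
    push_cast
    rw [hshift, hshift, hhalf_inv, hhalf_inv]
    ring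

/-- The pentagonal number theorem for a real number in `[0, 1)`. -/
lemma hasSum_pow_pentagonal {q : ℝ} (h0 : 0 ≤ q) (h1 : q < 1) :
    HasSum (fun k : ℤ ↦ (Int.negOnePow k : ℝ) * q ^ pentagonal k) (∏' n : ℕ, (1 - q ^ (n + 1))) := by
  have hgeom := summable_geometric_of_lt_one h0 h1
  have hs : Summable fun k : ℤ ↦ (Int.negOnePow k : ℝ) * q ^ pentagonal k := by
    refine Summable.of_norm_bounded (hgeom.comp_injective pentagonal_injective) fun k ↦ ?_
    rcases Int.even_or_odd k with hk | hk <;>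
      simp [Int.negOnePow_even, Int.negOnePow_odd, hk, abs_of_nonneg h0]
  have hnat := ((Equiv.neg ℤ).hasSum_iff.mpr hs.hasSum).nat_add_neg_add_one
  have hterm (k : ℕ) : ((fun k : ℤ ↦ (Int.negOnePow k : ℝ) * q ^ pentagonal k) ∘ Equiv.neg ℤ) k +
      ((fun k : ℤ ↦ (Int.negOnePow k : ℝ) * q ^ pentagonal k) ∘ Equiv.neg ℤ) (-(k + 1)) =
      (-1) ^ k * (q ^ pentagonal (-k) - q ^ pentagonal (k + 1)) := by
    simp only [Function.comp_apply, Equiv.neg_apply, neg_neg, Int.negOnePow_neg,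
      Int.negOnePow_succ]
    simp [Int.negOnePow_def]
    ring
  simp only [hterm] at hnat
  have hprod (k n : ℕ) : 0 ≤ ∏ i ∈ Finset.range (n + 1), (1 - q ^ (k + i + 1)) ∧
      ∏ i ∈ Finset.range (n + 1), (1 - q ^ (k + i + 1)) ≤ 1 :=
    ⟨Finset.prod_nonneg fun i _ ↦ sub_nonneg.mpr (pow_le_one₀ h0 h1.le),
      Finset.prod_le_one (fun i _ ↦ sub_nonneg.mpr (pow_le_one₀ h0 h1.le))
        fun i _ ↦ sub_le_self _ (by positivity)⟩
  have hbound (k n : ℕ) :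
      ‖q ^ ((k + 1) * n) * ∏ i ∈ Finset.range (n + 1), (1 - q ^ (k + i + 1))‖ ≤ q ^ n := by
    rw [Real.norm_of_nonneg (mul_nonneg (by positivity) (hprod k n).1)]
    refine (mul_le_of_le_one_right (by positivity) (hprod k n).2).trans ?_
    exact pow_le_pow_of_le_one h0 h1.le (Nat.le_mul_of_pos_left n k.succ_pos)
  have hmult (k : ℕ) : Multipliable fun n ↦ 1 - q ^ (n + k + 1) := by
    simpa [sub_eq_add_neg, add_assoc] using
      multipliable_one_add_of_summable (f := fun n ↦ -q ^ (n + k + 1))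
        (by simpa [add_assoc, abs_of_nonneg h0] using! (summable_nat_add_iff (k + 1)).mpr hgeom)
  rw [Pentagonal.tprod_one_sub_pow (tendsto_pow_atTop_nhds_zero_of_lt_one h0 h1)
    (fun k ↦ Summable.of_norm_bounded hgeom (hbound k)) hmult hnat.summable ?_,
    hnat.tsum_eq]
  · exact hs.hasSum
  · refine squeeze_zero_norm (a := fun k : ℕ ↦ q ^ k * (1 - q)⁻¹) (fun k ↦ ?_) ?_
    · rw [norm_mul, norm_mul, norm_pow, norm_neg, norm_one, one_pow, one_mul, norm_pow,
        Real.norm_of_nonneg h0]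
      refine mul_le_mul (pow_le_pow_of_le_one h0 h1.le ?_)
        (tsum_of_norm_bounded (hasSum_geometric_of_lt_one h0 h1) (hbound k)) (norm_nonneg _)
        (by positivity)
      rw [Nat.le_div_iff_mul_le two_pos]
      nlinarith
    · simpa using (tendsto_pow_atTop_nhds_zero_of_lt_one h0 h1).mul_const (1 - q)⁻¹

lemma add_mul_I_mem_integerComplement (a : ℝ) {b : ℝ} (hb : b ≠ 0) :
    (a + b * Complex.I : ℂ) ∈ Complex.integerComplement := by
  rintro ⟨n, hn⟩
  have := congrArg Complex.im hn
  simp at this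
  exact hb this.symm

lemma one_div_sub_one_div_conj {a s : ℝ} (hs : s ≠ 0) (n : ℤ) :
    ((1 / ((n + a) ^ 2 + s ^ 2) : ℝ) : ℂ) =
      1 / (2 * s * Complex.I) * (1 / (a + (-s : ℝ) * Complex.I + n) -
        1 / (a + s * Complex.I + n)) := by
  have hz := Complex.integerComplement_add_ne_zero
    (add_mul_I_mem_integerComplement a (neg_ne_zero.mpr hs)) n
  have hw := Complex.integerComplement_add_ne_zero (add_mul_I_mem_integerComplement a hs) n
  have hprod : ((n + a) ^ 2 + s ^ 2 : ℂ) =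
      (a + (-s : ℝ) * Complex.I + n) * (a + s * Complex.I + n) := by
    push_cast
    linear_combination (s : ℂ) ^ 2 * Complex.I_sq
  have hI : (2 * s * Complex.I : ℂ) ≠ 0 := by simpa using hs
  rw [div_sub_div _ _ hz hw, ← mul_div_mul_comm, ← hprod, one_mul, mul_comm (_ * _) (_ + _)]
  push_cast
  rw [show (1 * (a + s * Complex.I + n) - (a + -s * Complex.I + n) * 1 : ℂ) =
    2 * s * Complex.I by ring, div_mul_cancel_right₀ hI, one_div]

lemma summable_one_div_sq_add_sq {s : ℝ} (hs : s ≠ 0) (a : ℝ) :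
    Summable fun n : ℤ ↦ 1 / ((n + a) ^ 2 + s ^ 2) := by
  rw [← Complex.summable_ofReal]
  simp only [one_div_sub_one_div_conj hs]
  exact (summable_inv_add_int_sub_inv_add_int
    (add_mul_I_mem_integerComplement a (neg_ne_zero.mpr hs))
    (add_mul_I_mem_integerComplement a hs)).mul_left _

lemma hasSum_negOnePow_div_sq_add_sq {s : ℝ} (hs : 0 < s) :
    HasSum (fun n : ℤ ↦ (Int.negOnePow n : ℝ) * (1 / ((n + (-1 / 6 : ℝ)) ^ 2 + s ^ 2)))
      (√3 * Real.pi / s * (Real.sinh (2 * (Real.pi * s)) / Real.cosh (3 * (Real.pi * s)))) := by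
  have hsum := (hasSum_csc_sub_csc
    (add_mul_I_mem_integerComplement (-1 / 6) (neg_ne_zero.mpr hs.ne'))
    (add_mul_I_mem_integerComplement (-1 / 6) hs.ne')).mul_left (1 / (2 * s * Complex.I))
  rw [← Complex.hasSum_ofReal]
  convert! hsum using 1
  · ext n
    rw [Complex.ofReal_mul, one_div_sub_one_div_conj hs.ne']
    push_cast
    ring
  · have hsin (b : ℝ) : Complex.sin (Real.pi * ((-1 / 6 : ℝ) + b * Complex.I)) =
        ((-1 / 2 * Real.cosh (Real.pi * b) : ℝ) : ℂ) +
          ((√3 / 2 * Real.sinh (Real.pi * b) : ℝ) : ℂ) * Complex.I := by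
      have h6 : (Real.pi : ℂ) * (-1 / 6 : ℝ) = ((-(Real.pi / 6) : ℝ) : ℂ) := by push_cast; ring
      rw [mul_add, ← mul_assoc, h6, Complex.sin_add, Complex.sin_mul_I, Complex.cos_mul_I,
        ← Complex.ofReal_sin, ← Complex.ofReal_cos, Real.sin_neg, Real.cos_neg,
        Real.sin_pi_div_six, Real.cos_pi_div_six]
      push_cast
      ring
    rw [hsin, hsin, mul_neg, Real.cosh_neg, Real.sinh_neg, Real.sinh_two_mul, Real.cosh_three_mul]
    set u := Real.pi * s
    have hC : 0 < Real.cosh u := Real.cosh_pos u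
    have hCS := Real.cosh_sq u
    have hD : 0 < 1 + 4 * Real.sinh u ^ 2 := by positivity
    have h3 : (√3 : ℝ) ^ 2 = 3 := Real.sq_sqrt (by norm_num)
    have hden : 4 * Real.cosh u ^ 3 - 3 * Real.cosh u =
        Real.cosh u * (1 + 4 * Real.sinh u ^ 2) := by
      linear_combination 4 * Real.cosh u * hCS
    rw [hden]
    generalize Real.cosh u = C at *
    generalize Real.sinh u = S at *
    have hC' : (C : ℂ) ≠ 0 := by exact_mod_cast hC.ne'
    have hD' : (1 + 4 * S ^ 2 : ℂ) ≠ 0 := by exact_mod_cast hD.ne'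
    have hs' : (s : ℂ) ≠ 0 := by exact_mod_cast hs.ne'
    have h3' : (√3 : ℂ) ^ 2 = 3 := by exact_mod_cast h3
    have hCS' : (C : ℂ) ^ 2 = S ^ 2 + 1 := by exact_mod_cast hCS
    have hprod : ((-1 / 2 * C : ℝ) + (√3 / 2 * -S : ℝ) * Complex.I : ℂ) *
        ((-1 / 2 * C : ℝ) + (√3 / 2 * S : ℝ) * Complex.I) = (1 + 4 * S ^ 2) / 4 := by
      push_cast
      linear_combination 1 / 4 * hCS' + S ^ 2 / 4 * h3' - (√3 : ℂ) ^ 2 / 4 * S ^ 2 * Complex.I_sq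
    have hne : ((-1 / 2 * C : ℝ) + (√3 / 2 * -S : ℝ) * Complex.I : ℂ) *
        ((-1 / 2 * C : ℝ) + (√3 / 2 * S : ℝ) * Complex.I) ≠ 0 := by
      rw [hprod]
      exact div_ne_zero hD' (by norm_num)
    rw [div_sub_div _ _ (left_ne_zero_of_mul hne) (right_ne_zero_of_mul hne), hprod]
    push_cast
    field_simp
    ring

/-- The expansion of `η(ix)` given by the pentagonal number theorem. -/
lemma hasSum_exp_mul_tprod_one_sub_exp {x : ℝ} (hx : 0 < x) :
    HasSum (fun k : ℤ ↦ (Int.negOnePow k : ℝ) *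
        Real.exp (-(3 * Real.pi * (k + (-1 / 6 : ℝ)) ^ 2) * x))
      (Real.exp (-Real.pi * x / 12) * ∏' n : ℕ, (1 - Real.exp (-2 * Real.pi * (n + 1) * x))) := by
  have hpow (m : ℕ) : Real.exp (-2 * Real.pi * x) ^ m = Real.exp (-2 * Real.pi * m * x) := by
    rw [← Real.exp_nat_mul]
    ring_nf
  have h := (hasSum_pow_pentagonal (Real.exp_nonneg (-2 * Real.pi * x))
    (by simp; positivity)).mul_left (Real.exp (-Real.pi * x / 12))
  simp only [hpow, Nat.cast_add, Nat.cast_one] at h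
  refine h.congr_fun fun k ↦ ?_
  have hk : 2 * (pentagonal k : ℝ) = k * (3 * k - 1) := by
    exact_mod_cast two_mul_natCast_pentagonal k
  rw [mul_left_comm, ← Real.exp_add]
  congr 2
  linear_combination Real.pi * x * hk

/-- The Laplace transform of the Dedekind eta function `η(ix)`
(Glasser's identity). -/
theorem laplace_dedekind_eta (t : ℝ) (ht : 0 < t) :
    ∫ x : ℝ in Ioi 0,
        Real.exp (-t * x) * (Real.exp (-Real.pi * x / 12) *
          ∏' n : ℕ, (1 - Real.exp (-2 * Real.pi * (n + 1) * x)))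
      = Real.sqrt (Real.pi / t) *
          Real.sinh (2 * Real.sqrt (Real.pi * t / 3)) /
          Real.cosh (Real.sqrt (3 * Real.pi * t)) := by
  have hpi := Real.pi_pos
  obtain ⟨s, hs, rfl⟩ : ∃ s : ℝ, 0 < s ∧ t = 3 * Real.pi * s ^ 2 :=
    ⟨√(t / (3 * Real.pi)), by positivity, by rw [Real.sq_sqrt (by positivity)]; field_simp⟩
  have hsq (a b : ℝ) (hb : 0 < b) (h : a = b ^ 2) : √a = b := by rw [h, Real.sqrt_sq hb.le]
  have h3 : √3 ^ 2 = (3 : ℝ) := Real.sq_sqrt (by norm_num)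
  rw [hsq (Real.pi / (3 * Real.pi * s ^ 2)) (√3 / (3 * s)) (by positivity)
      (by rw [div_pow, h3]; field_simp),
    hsq (Real.pi * (3 * Real.pi * s ^ 2) / 3) (Real.pi * s) (by positivity) (by ring),
    hsq (3 * Real.pi * (3 * Real.pi * s ^ 2)) (3 * (Real.pi * s)) (by positivity) (by ring)]
  set c : ℤ → ℝ := fun k ↦ 3 * Real.pi * ((k + (-1 / 6 : ℝ)) ^ 2 + s ^ 2) with hc
  have hc_pos (k : ℤ) : 0 < c k := by positivity
  have hint (k : ℤ) : ∫ x in Ioi (0 : ℝ), Real.exp (-c k * x) = 1 / c k := by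
    rw [integral_exp_mul_Ioi (neg_neg_of_pos (hc_pos k))]
    simp
  have hnorm (k : ℤ) : ‖(Int.negOnePow k : ℝ)‖ = 1 := by
    rcases Int.even_or_odd k with hk | hk <;> simp [Int.negOnePow_even, Int.negOnePow_odd, hk]
  have hc_div (k : ℤ) : 1 / c k =
      1 / (3 * Real.pi) * (1 / ((k + (-1 / 6 : ℝ)) ^ 2 + s ^ 2)) := by
    rw [one_div_mul_one_div]
  have hsum := hasSum_integral_of_summable_integral_norm
    (F := fun (k : ℤ) x ↦ (Int.negOnePow k : ℝ) * Real.exp (-c k * x))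
    (μ := volume.restrict (Ioi 0))
    (fun k ↦ (integrableOn_exp_mul_Ioi (neg_neg_of_pos (hc_pos k)) 0).const_mul _) (by
      simp only [norm_mul, hnorm, one_mul, Real.norm_of_nonneg (Real.exp_nonneg _), hint, hc_div]
      exact (summable_one_div_sq_add_sq hs.ne' _).mul_left _)
  simp only [integral_const_mul, hint, hc_div] at hsum
  have hval := (hasSum_negOnePow_div_sq_add_sq hs).mul_left (1 / (3 * Real.pi))
  simp only [mul_left_comm (1 / (3 * Real.pi))] at hval
  calc _ = ∫ x in Ioi (0 : ℝ), ∑' k : ℤ, (Int.negOnePow k : ℝ) * Real.exp (-c k * x) := by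
        refine setIntegral_congr_fun measurableSet_Ioi fun x hx ↦ ?_
        refine (((hasSum_exp_mul_tprod_one_sub_exp hx).mul_left _).congr_fun fun k ↦ ?_).tsum_eq.symm
        rw [mul_left_comm, ← Real.exp_add, hc]
        ring_nf
    _ = _ := hsum.unique hval
    _ = _ := by
      field_simp
end
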